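/- arXiv:2310.16636 — 11 statements merged into one kernel-verified Lean document; each statement's English description precedes it below -/
import Mathlib

section
/- Let p : E → B be a surjective morphism of closure spaces with closure operators cl_E, cl_B. For X ⊆ B define p_∞(X) := ⋂ { S ⊆ B | X ⊆ S and p(cl_E(p⁻¹(S))) ⊆ S } (for surjective p this least fixed point agrees with the transfinite iteration of the operator S ↦ p(cl_E(p⁻¹(S))) starting at X). Then the following are equivalent: (a) p is a regular epimorphism, i.e. for every X ⊆ B, X is closed in B if and only if p⁻¹(X) is closed in E; (b) cl_B(X) ⊆ p_∞(X) for every X ⊆ B; (c) cl_B(X) = p_∞(X) for every X ⊆ B. -/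
/-- The least fixed point `p_∞(X)`: the intersection of all `S ⊇ X` with
`p(cl_E(p⁻¹(S))) ⊆ S`.  For surjective `p` this coincides with the transfinite
iteration of `S ↦ p(cl_E(p⁻¹(S)))` starting at `X`. -/
def pInfty {E B : Type*} (cE : ClosureOperator (Set E)) (p : E → B) (X : Set B) : Set B :=
  ⋂₀ {S : Set B | X ⊆ S ∧ p '' cE (p ⁻¹' S) ⊆ S}

/-- The sets `S` in the definition of `pInfty` are those whose preimage is closed. -/
theorem image_closure_preimage_subset_iff {E B : Type*} (cE : ClosureOperator (Set E))
    (p : E → B) (S : Set B) : p '' cE (p ⁻¹' S) ⊆ S ↔ cE (p ⁻¹' S) = p ⁻¹' S := by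
  rw [Set.image_subset_iff]
  exact ⟨fun h => h.antisymm (cE.le_closure _), fun h => h.subset⟩

theorem pInfty_subset {E B : Type*} {cE : ClosureOperator (Set E)} {p : E → B} {X S : Set B}
    (hXS : X ⊆ S) (hS : cE (p ⁻¹' S) = p ⁻¹' S) : pInfty cE p X ⊆ S :=
  Set.sInter_subset_of_mem ⟨hXS, (image_closure_preimage_subset_iff cE p S).2 hS⟩

/-- Proposition 2.7: characterizations of regular epimorphisms of closure spaces. -/
theorem regular_epi_tfae {E B : Type*} (cE : ClosureOperator (Set E))
    (cB : ClosureOperator (Set B)) (p : E → B)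
    (hsurj : Function.Surjective p)
    (hcont : ∀ B' : Set B, cB B' = B' → cE (p ⁻¹' B') = p ⁻¹' B') :
    List.TFAE
      [ ∀ X : Set B, cB X = X ↔ cE (p ⁻¹' X) = p ⁻¹' X,
        ∀ X : Set B, cB X ⊆ pInfty cE p X,
        ∀ X : Set B, cB X = pInfty cE p X ] := by
  tfae_have 1 → 2 := fun h X => Set.subset_sInter fun S ⟨hXS, hS⟩ =>
    (cB.monotone hXS).trans ((h S).2 ((image_closure_preimage_subset_iff cE p S).1 hS)).subset
  tfae_have 2 → 3 := fun h X =>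
    (h X).antisymm (pInfty_subset (cB.le_closure X) (hcont _ (cB.idempotent X)))
  tfae_have 3 → 1 := fun h X =>
    ⟨hcont X, fun hX => ((h X).subset.trans (pInfty_subset subset_rfl hX)).antisymm
      (cB.le_closure X)⟩
  tfae_finish
end

section
/- Let p : E → B be a surjective morphism of closure spaces with closure operators cl_E, cl_B. The following are equivalent: (b) cl_B(X) ⊆ p(cl_E(p⁻¹(X))) for every X ⊆ B; (c) cl_B(X) = p(cl_E(p⁻¹(X))) for every X ⊆ B; (d) p(cl_E(p⁻¹(X))) is closed in B for every X ⊆ B. -/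
/-- Proposition 2.10 (b) ⇔ (c) ⇔ (d): for a surjective morphism of closure
spaces `p : E → B`, the descent-morphism conditions. -/
theorem descent_morphism_tfae {E B : Type*}
    (cE : ClosureOperator (Set E)) (cB : ClosureOperator (Set B)) (p : E → B)
    (hsurj : Function.Surjective p)
    (hcont : ∀ B' : Set B, cB B' = B' → cE (p ⁻¹' B') = p ⁻¹' B') :
    List.TFAE
      [ ∀ X : Set B, cB X ⊆ p '' cE (p ⁻¹' X),
        ∀ X : Set B, cB X = p '' cE (p ⁻¹' X),
        ∀ X : Set B, cB (p '' cE (p ⁻¹' X)) = p '' cE (p ⁻¹' X) ] := by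
  have image_subset (X : Set B) : p '' cE (p ⁻¹' X) ⊆ cB X := by
    rw [Set.image_subset_iff, ← hcont (cB X) (cB.idempotent X)]
    exact cE.monotone (Set.preimage_mono (cB.le_closure X))
  have subset_image (X : Set B) : X ⊆ p '' cE (p ⁻¹' X) := by
    rw [← Set.image_preimage_eq X hsurj, Set.preimage_image_preimage]
    exact Set.image_mono (cE.le_closure _)
  tfae_have 1 → 2 := fun h X => (h X).antisymm (image_subset X)
  tfae_have 2 → 3 := fun h X => by rw [← h X, cB.idempotent]
  tfae_have 3 → 1 := fun h X => (cB.monotone (subset_image X)).trans (h X).le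
  tfae_finish
end

section
/- Let p : E → B be a surjective morphism of closure spaces such that for every subset S ⊆ B the restriction p' : p⁻¹(S) → S of p (between the subspace structures) is a regular epimorphism; concretely, assume that for all X ⊆ S ⊆ B, if cl_E(p⁻¹(X)) ∩ p⁻¹(S) ⊆ p⁻¹(X) then cl_B(X) ∩ S ⊆ X. Then cl_B(X) ⊆ p(cl_E(p⁻¹(X))) for every X ⊆ B. -/
/-- Proposition 2.10 (a) ⇒ (b): if every restriction `p' : p⁻¹(S) → S` of a
surjective morphism `p : E → B` of closure spaces (with subspace structures)
is a regular epimorphism, then `cl_B(X) ⊆ p(cl_E(p⁻¹(X)))` for every `X ⊆ B`. -/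
theorem stable_regular_epi_implies_descent {E B : Type*}
    (cE : ClosureOperator (Set E)) (cB : ClosureOperator (Set B)) (p : E → B)
    (hsurj : Function.Surjective p)
    (hcont : ∀ B' : Set B, cB B' = B' → cE (p ⁻¹' B') = p ⁻¹' B')
    (hreg : ∀ X S : Set B, X ⊆ S →
      (cE (p ⁻¹' X) ∩ p ⁻¹' S ⊆ p ⁻¹' X → cB X ∩ S ⊆ X)) :
    ∀ X : Set B, cB X ⊆ p '' cE (p ⁻¹' X) := by
  intro X b hb
  by_contra hb'
  have hbX : b ∈ X := by
    refine hreg X (insert b X) (Set.subset_insert b X) ?_ ⟨hb, Set.mem_insert b X⟩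
    rintro e ⟨he, rfl | heX⟩
    · exact absurd ⟨e, he, rfl⟩ hb'
    · exact heX
  obtain ⟨e, rfl⟩ := hsurj b
  exact hb' ⟨e, cE.le_closure (p ⁻¹' X) hbX, rfl⟩
end

section
/- Let p : E → B be a morphism of closure spaces such that cl_B(X) = p(cl_E(p⁻¹(X))) for every X ⊆ B. Then for every closure space A with closure operator cl_A, every morphism α : A → B, and every U ⊆ A, one has cl_A(U) ⊆ π₂( π₁⁻¹(cl_E(π₁(π₂⁻¹(U)))) ∩ π₂⁻¹(cl_A(π₂(π₂⁻¹(U)))) ), where π₁, π₂ are the projections of the pullback E ×_B A = {(e,a) | p(e) = α(a)}; i.e. the closure of π₂⁻¹(U) in the pullback structure maps onto cl_A(U), so the pullback projection π₂ is a regular epimorphism of closure spaces. -/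
/-- Proposition 2.10 (c) ⇒ (a): if `cl_B(X) = p(cl_E(p⁻¹(X)))` for every
`X ⊆ B`, then for every morphism `α : A → B` and every `U ⊆ A`, the closure of
`π₂⁻¹(U)` in the pullback `E ×_B A` maps onto `cl_A(U)` under `π₂`; hence the
pullback projection `π₂` is a regular epimorphism of closure spaces. -/
theorem descent_condition_pullback_stable {E B A : Type*}
    (cE : ClosureOperator (Set E)) (cB : ClosureOperator (Set B))
    (cA : ClosureOperator (Set A)) (p : E → B) (α : A → B)
    (hp : ∀ B' : Set B, cB B' = B' → cE (p ⁻¹' B') = p ⁻¹' B')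
    (hα : ∀ B' : Set B, cB B' = B' → cA (α ⁻¹' B') = α ⁻¹' B')
    (hc : ∀ X : Set B, cB X = p '' cE (p ⁻¹' X))
    (π₁ : {ea : E × A // p ea.1 = α ea.2} → E)
    (π₂ : {ea : E × A // p ea.1 = α ea.2} → A)
    (hπ₁ : ∀ z, π₁ z = z.1.1) (hπ₂ : ∀ z, π₂ z = z.1.2) :
    ∀ U : Set A,
      cA U ⊆ π₂ '' (π₁ ⁻¹' (cE (π₁ '' (π₂ ⁻¹' U))) ∩
        π₂ ⁻¹' (cA (π₂ '' (π₂ ⁻¹' U)))) := by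
  intro U a ha
  have h_surj : Function.Surjective p := fun b => by
    have hb : b ∈ p '' cE (p ⁻¹' {b}) := hc {b} ▸ cB.le_closure {b} rfl
    obtain ⟨e, -, he⟩ := hb
    exact ⟨e, he⟩
  have h_fst : π₁ '' (π₂ ⁻¹' U) = p ⁻¹' (α '' U) := by
    ext e
    constructor
    · rintro ⟨z, hz, rfl⟩
      rw [Set.mem_preimage, hπ₂] at hz
      rw [hπ₁]
      exact ⟨z.1.2, hz, z.2.symm⟩
    · rintro ⟨u, hu, hue⟩
      exact ⟨⟨(e, u), hue.symm⟩, by rwa [Set.mem_preimage, hπ₂], hπ₁ _⟩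
  have h_snd : π₂ '' (π₂ ⁻¹' U) = U := Set.image_preimage_eq U fun u => by
    obtain ⟨e, he⟩ := h_surj (α u)
    exact ⟨⟨(e, u), he⟩, hπ₂ _⟩
  have h_mem : α a ∈ cB (α '' U) := by
    have h_sub : U ⊆ α ⁻¹' cB (α '' U) := fun u hu =>
      cB.le_closure (α '' U) (Set.mem_image_of_mem α hu)
    have h_cl := cA.monotone h_sub ha
    rwa [hα _ (cB.idempotent _)] at h_cl
  rw [hc] at h_mem
  obtain ⟨e, he, hea⟩ := h_mem
  rw [h_fst, h_snd]
  exact ⟨⟨(e, a), hea⟩, ⟨by rwa [Set.mem_preimage, hπ₁], by rwa [Set.mem_preimage, hπ₂]⟩, hπ₂ _⟩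
end

section
/- Let c and c' be two closure operators on the same set E with c'(Y) ⊆ c(Y) for all Y ⊆ E, and let p : E → B be a surjective morphism from (E, c) to a closure space B. Write E ×_B E' = {(e₁,e₂) ∈ E × E | p(e₁) = p(e₂)} with projections π₁, π₂, where the first factor carries c and the second carries c'. Then the following are equivalent: (d) π₁ : E ×_B E' → (E, c') is a morphism for the pullback structure, i.e. for every Y ⊆ E with c'(Y) = Y one has π₁⁻¹(c(π₁(π₁⁻¹(Y)))) ∩ π₂⁻¹(c'(π₂(π₁⁻¹(Y)))) ⊆ π₁⁻¹(Y); (e) c(Y) ∩ p⁻¹(p(c'(p⁻¹(p(Y))))) ⊆ c'(Y) for all Y ⊆ E; (f) c(Y) ∩ p⁻¹(p(c'(p⁻¹(p(Y))))) = c'(Y) for all Y ⊆ E; (g) c(Y) ∩ p⁻¹(p(c'(p⁻¹(p(Y))))) ⊆ Y for all Y with c'(Y) = Y; (h) c(Y) ∩ p⁻¹(p(c'(p⁻¹(p(Y))))) = Y for all Y with c'(Y) = Y. -/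
/-- Lemma 4.1 ((d) ⇔ (e) ⇔ (f) ⇔ (g) ⇔ (h)): for closure operators `c, c'` on
`E` with `c' ≤ c` and a surjective morphism `p : (E,c) → B`, the conditions
characterizing when the first projection of the pullback `E ×_B E'` (first
factor with structure `c`, second with `c'`) is a morphism into `(E, c')`. -/
theorem descent_data_tfae {E B : Type*}
    (c c' : ClosureOperator (Set E)) (cB : ClosureOperator (Set B)) (p : E → B)
    (hle : ∀ Y : Set E, c' Y ⊆ c Y)
    (hsurj : Function.Surjective p)
    (hcont : ∀ X : Set B, cB X = X → c (p ⁻¹' X) = p ⁻¹' X)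
    (π₁ : {ee : E × E // p ee.1 = p ee.2} → E)
    (π₂ : {ee : E × E // p ee.1 = p ee.2} → E)
    (hπ₁ : ∀ z, π₁ z = z.1.1) (hπ₂ : ∀ z, π₂ z = z.1.2) :
    List.TFAE
      [ ∀ Y : Set E, c' Y = Y →
          π₁ ⁻¹' (c (π₁ '' (π₁ ⁻¹' Y))) ∩ π₂ ⁻¹' (c' (π₂ '' (π₁ ⁻¹' Y))) ⊆ π₁ ⁻¹' Y,
        ∀ Y : Set E, c Y ∩ p ⁻¹' (p '' c' (p ⁻¹' (p '' Y))) ⊆ c' Y,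
        ∀ Y : Set E, c Y ∩ p ⁻¹' (p '' c' (p ⁻¹' (p '' Y))) = c' Y,
        ∀ Y : Set E, c' Y = Y → c Y ∩ p ⁻¹' (p '' c' (p ⁻¹' (p '' Y))) ⊆ Y,
        ∀ Y : Set E, c' Y = Y → c Y ∩ p ⁻¹' (p '' c' (p ⁻¹' (p '' Y))) = Y ] := by
  have image_fst (Y : Set E) : π₁ '' (π₁ ⁻¹' Y) = Y :=
    Set.image_preimage_eq Y fun e => ⟨⟨(e, e), rfl⟩, hπ₁ _⟩
  have image_snd (Y : Set E) : π₂ '' (π₁ ⁻¹' Y) = p ⁻¹' (p '' Y) := by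
    ext e
    constructor
    · rintro ⟨z, hz, rfl⟩
      exact ⟨π₁ z, hz, by rw [hπ₁, hπ₂, z.2]⟩
    · rintro ⟨y, hy, hye⟩
      exact ⟨⟨(y, e), hye⟩, by rwa [Set.mem_preimage, hπ₁], hπ₂ _⟩
  have closure_subset (Y : Set E) :
      c' Y ⊆ c Y ∩ p ⁻¹' (p '' c' (p ⁻¹' (p '' Y))) :=
    Set.subset_inter (hle Y)
      ((c'.monotone (Set.subset_preimage_image p Y)).trans (Set.subset_preimage_image p _))
  tfae_have 1 → 4 := by
    rintro h Y hY e ⟨he, e', he', hp⟩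
    have hmem := @h Y hY ⟨(e, e'), hp.symm⟩
    rw [image_fst, image_snd, Set.mem_inter_iff] at hmem
    simp only [Set.mem_preimage, hπ₁, hπ₂] at hmem
    exact hmem ⟨he, he'⟩
  tfae_have 4 → 1 := by
    rintro h Y hY z ⟨h₁, h₂⟩
    rw [image_fst] at h₁
    rw [image_snd] at h₂
    exact h Y hY ⟨h₁, π₂ z, h₂, by rw [hπ₁, hπ₂, z.2]⟩
  tfae_have 4 → 2 := fun h Y =>
    (Set.inter_subset_inter (c.monotone (c'.le_closure Y))
      (Set.preimage_mono (Set.image_mono (c'.monotone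
        (Set.preimage_mono (Set.image_mono (c'.le_closure Y))))))).trans
      (h (c' Y) (c'.idempotent Y))
  tfae_have 2 → 3 := fun h Y => (h Y).antisymm (closure_subset Y)
  tfae_have 3 → 5 := fun h Y hY => (h Y).trans hY
  tfae_have 5 → 4 := fun h Y hY => (h Y hY).subset
  tfae_finish
end

section
/- Let c and c' be closure operators on a set E with c'(Y) ⊆ c(Y) for all Y ⊆ E, let p : E → B be a surjective map, and let cl_B be a closure operator on B such that for every X ⊆ B: (X is cl_B-closed ⟺ p⁻¹(X) is c-closed) and (X is cl_B-closed ⟺ p⁻¹(X) is c'-closed) (i.e. p is a regular epimorphism from both (E,c) and (E,c') to B). Assume moreover that c(Y) ∩ p⁻¹(p(c'(p⁻¹(p(Y))))) = Y for every Y ⊆ E with c'(Y) = Y. Then for every Y ⊆ E that is c'-closed but not c-closed, the set Y* := c'(p⁻¹(p(Y))) is c'-closed, not c-closed, and strictly contains Y. -/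
/-- Lemma 4.2: let `c, c'` be closure operators on `E` with `c' ≤ c`, and let
`p : E → B` be surjective and a regular epimorphism from both `(E,c)` and
`(E,c')` to `B`; assume condition (h) of Lemma 4.1.  Then for every `Y` that is
`c'`-closed but not `c`-closed, `Y* := c'(p⁻¹(p(Y)))` is `c'`-closed, not
`c`-closed, and strictly contains `Y`. -/
theorem strictly_larger_bad_closed_set {E B : Type*}
    (c c' : ClosureOperator (Set E)) (cB : ClosureOperator (Set B)) (p : E → B)
    (hle : ∀ Y : Set E, c' Y ⊆ c Y)
    (hsurj : Function.Surjective p)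
    (hreg : ∀ X : Set B, cB X = X ↔ c (p ⁻¹' X) = p ⁻¹' X)
    (hreg' : ∀ X : Set B, cB X = X ↔ c' (p ⁻¹' X) = p ⁻¹' X)
    (hfix : ∀ Y : Set E, c' Y = Y →
      c Y ∩ p ⁻¹' (p '' c' (p ⁻¹' (p '' Y))) = Y) :
    ∀ Y : Set E, c' Y = Y → ¬ (c Y = Y) →
      c' (c' (p ⁻¹' (p '' Y))) = c' (p ⁻¹' (p '' Y)) ∧
      ¬ (c (c' (p ⁻¹' (p '' Y))) = c' (p ⁻¹' (p '' Y))) ∧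
      Y ⊂ c' (p ⁻¹' (p '' Y)) := by
  intro Y hY hcY
  have hsub : Y ⊆ c' (p ⁻¹' (p '' Y)) :=
    (Set.subset_preimage_image p Y).trans (c'.le_closure _)
  refine ⟨c'.idempotent _, fun h => hcY ?_, hsub, fun hsup => hcY ?_⟩
  · have hcsub : c Y ⊆ c' (p ⁻¹' (p '' Y)) := (c.monotone hsub).trans h.le
    have hY' := hfix Y hY
    rwa [Set.inter_eq_left.mpr (hcsub.trans (Set.subset_preimage_image p _))] at hY'
  · have hsat : p ⁻¹' (p '' Y) = Y :=
      ((c'.le_closure _).trans hsup).antisymm (Set.subset_preimage_image p Y)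
    have hclosed := (hreg (p '' Y)).mp ((hreg' (p '' Y)).mpr (by rw [hsat, hY]))
    rwa [hsat] at hclosed
end

section
/- Let E be a finite set, let c and c' be closure operators on E with c'(Y) ⊆ c(Y) for all Y ⊆ E, let p : E → B be a surjective map, and let cl_B be a closure operator on B such that for every X ⊆ B: (X is cl_B-closed ⟺ p⁻¹(X) is c-closed) and (X is cl_B-closed ⟺ p⁻¹(X) is c'-closed). Assume that c(Y) ∩ p⁻¹(p(c'(p⁻¹(p(Y))))) = Y for every Y ⊆ E with c'(Y) = Y. Then c and c' have the same closed sets, i.e. for every Y ⊆ E, c(Y) = Y if and only if c'(Y) = Y (equivalently c = c'). In particular, if the closed sets of c' and c differ, E must be infinite. -/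
/-- Theorem 4.3 (set-theoretic core): in the situation of Lemma 4.2, if `E` is
finite then `c` and `c'` have the same closed sets. -/
theorem finite_descent_effective {E B : Type*} [Finite E]
    (c c' : ClosureOperator (Set E)) (cB : ClosureOperator (Set B)) (p : E → B)
    (hle : ∀ Y : Set E, c' Y ⊆ c Y)
    (hsurj : Function.Surjective p)
    (hreg : ∀ X : Set B, cB X = X ↔ c (p ⁻¹' X) = p ⁻¹' X)
    (hreg' : ∀ X : Set B, cB X = X ↔ c' (p ⁻¹' X) = p ⁻¹' X)
    (hfix : ∀ Y : Set E, c' Y = Y →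
      c Y ∩ p ⁻¹' (p '' c' (p ⁻¹' (p '' Y))) = Y) :
    ∀ Y : Set E, c Y = Y ↔ c' Y = Y := by
  have le_c' (Z : Set E) : Z ⊆ c' Z := c'.le_closure Z
  have closed_of_closed' : ∀ Y : Set E, c' Y = Y → c Y = Y := by
    intro Y
    -- Well-founded induction on strictly larger subsets of the finite set `E`.
    induction Y using WellFoundedGT.induction with
    | ind Y ih =>
    intro hY
    have hYZ : Y ⊆ c' (p ⁻¹' (p '' Y)) := (Set.subset_preimage_image p Y).trans (le_c' _)
    rcases hYZ.eq_or_ssubset with heq | hlt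
    · have hsat : p ⁻¹' (p '' Y) = Y :=
        ((le_c' _).trans heq.ge).antisymm (Set.subset_preimage_image p Y)
      have hclosed := (hreg (p '' Y)).1 ((hreg' (p '' Y)).2 (by rw [hsat, hY]))
      rwa [hsat] at hclosed
    · have hZ := ih _ hlt (c'.idempotent _)
      have hcY : c Y ⊆ c' (p ⁻¹' (p '' Y)) := (c.monotone hYZ).trans hZ.le
      rw [← Set.inter_eq_left.2 (hcY.trans (Set.subset_preimage_image p _))]
      exact hfix Y hY
  exact fun Y => ⟨fun h => ((hle Y).trans h.le).antisymm (le_c' Y), closed_of_closed' Y⟩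
end

section
/- Let p : E → B be a closed morphism of closure spaces and α : A → B any morphism of closure spaces, and let π₁, π₂ be the projections of the pullback E ×_B A = {(e,a) | p(e) = α(a)}. Then for every E' closed in E and A' closed in A one has π₂( π₁⁻¹(E') ∩ π₂⁻¹(A') ) = α⁻¹(p(E')) ∩ A', and this set is closed in A; hence the image under π₂ of every closed set of the pullback structure is closed in A, i.e. π₂ is a closed map. In particular, the class of closed morphisms of closure spaces is pullback stable, and so is the class of surjective closed morphisms. -/
/-- Proposition 6.2: closed morphisms of closure spaces are pullback stable.
For a closed morphism `p : E → B` and any morphism `α : A → B`, the image under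
`π₂` of each closed set `π₁⁻¹(E') ∩ π₂⁻¹(A')` of the pullback equals
`α⁻¹(p(E')) ∩ A'`, which is closed in `A`; hence `π₂` is a closed map. -/
theorem closed_maps_pullback_stable {E B A : Type*}
    (cE : ClosureOperator (Set E)) (cB : ClosureOperator (Set B))
    (cA : ClosureOperator (Set A)) (p : E → B) (α : A → B)
    (hp : ∀ B' : Set B, cB B' = B' → cE (p ⁻¹' B') = p ⁻¹' B')
    (hpc : ∀ Y : Set E, cE Y = Y → cB (p '' Y) = p '' Y)
    (hα : ∀ B' : Set B, cB B' = B' → cA (α ⁻¹' B') = α ⁻¹' B')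
    (π₁ : {ea : E × A // p ea.1 = α ea.2} → E)
    (π₂ : {ea : E × A // p ea.1 = α ea.2} → A)
    (hπ₁ : ∀ z, π₁ z = z.1.1) (hπ₂ : ∀ z, π₂ z = z.1.2) :
    ∀ E' : Set E, ∀ A' : Set A, cE E' = E' → cA A' = A' →
      π₂ '' (π₁ ⁻¹' E' ∩ π₂ ⁻¹' A') = α ⁻¹' (p '' E') ∩ A' ∧
      cA (α ⁻¹' (p '' E') ∩ A') = α ⁻¹' (p '' E') ∩ A' := by
  intro E' A' hE' hA'
  refine ⟨?_, ?_⟩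
  · ext a
    constructor
    · rintro ⟨z, ⟨hzE, hzA⟩, rfl⟩
      refine ⟨⟨π₁ z, hzE, ?_⟩, hzA⟩
      rw [hπ₁, hπ₂]
      exact z.2
    · rintro ⟨⟨e, he, hea⟩, ha⟩
      refine ⟨⟨(e, a), hea⟩, ⟨?_, ?_⟩, hπ₂ _⟩
      · simpa [hπ₁] using he
      · simpa [hπ₂] using ha
  · refine (Set.subset_inter ?_ ?_).antisymm (cA.le_closure _)
    · exact (cA.monotone Set.inter_subset_left).trans (hα _ (hpc _ hE')).le
    · exact (cA.monotone Set.inter_subset_right).trans hA'.le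
end

section
/- Let p : E → B be a surjective open morphism of closure spaces and α : A → B any morphism of closure spaces, and let π₁, π₂ be the projections of the pullback E ×_B A = {(e,a) | p(e) = α(a)} with its pullback closure space structure. Then π₂ is surjective, and for every U ⊆ A the closure of π₂⁻¹(U) in the pullback equals π₂⁻¹(cl_A(U)); concretely π₁⁻¹(cl_E(π₁(π₂⁻¹(U)))) ∩ π₂⁻¹(cl_A(U)) = π₂⁻¹(cl_A(U)). Hence π₂ is a surjective open map, i.e. the class of surjective open morphisms of closure spaces is pullback stable. -/
/-- Proposition 6.3: surjective open morphisms of closure spaces are pullback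
stable.  For a surjective open morphism `p : E → B` and any morphism
`α : A → B`, the projection `π₂` of the pullback is surjective, and the closure
of `π₂⁻¹(U)` in the pullback equals `π₂⁻¹(cl_A(U))` for every `U ⊆ A`; hence
`π₂` is a surjective open map. -/
theorem surjective_open_maps_pullback_stable {E B A : Type*}
    (cE : ClosureOperator (Set E)) (cB : ClosureOperator (Set B))
    (cA : ClosureOperator (Set A)) (p : E → B) (α : A → B)
    (hsurj : Function.Surjective p)
    (hopen : ∀ X : Set B, cE (p ⁻¹' X) = p ⁻¹' (cB X))
    (hα : ∀ B' : Set B, cB B' = B' → cA (α ⁻¹' B') = α ⁻¹' B')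
    (π₁ : {ea : E × A // p ea.1 = α ea.2} → E)
    (π₂ : {ea : E × A // p ea.1 = α ea.2} → A)
    (hπ₁ : ∀ z, π₁ z = z.1.1) (hπ₂ : ∀ z, π₂ z = z.1.2) :
    Function.Surjective π₂ ∧
    ∀ U : Set A,
      π₁ ⁻¹' (cE (π₁ '' (π₂ ⁻¹' U))) ∩ π₂ ⁻¹' (cA U) = π₂ ⁻¹' (cA U) := by
  obtain rfl : π₁ = fun z => z.1.1 := funext hπ₁
  obtain rfl : π₂ = fun z => z.1.2 := funext hπ₂
  refine ⟨fun a => ?_, fun U => Set.inter_eq_right.mpr ?_⟩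
  · obtain ⟨e, he⟩ := hsurj (α a)
    exact ⟨⟨(e, a), he⟩, rfl⟩
  · rintro ⟨⟨e, a⟩, hea⟩ ha
    have himage : (fun z : {ea : E × A // p ea.1 = α ea.2} => z.1.1) ''
        ((fun z => z.1.2) ⁻¹' U) = p ⁻¹' (α '' U) := by
      ext x
      constructor
      · rintro ⟨⟨⟨x, u⟩, h⟩, hu, rfl⟩
        exact ⟨u, hu, h.symm⟩
      · rintro ⟨u, hu, h⟩
        exact ⟨⟨(x, u), h.symm⟩, hu, rfl⟩
    have hclosure : cA U ⊆ α ⁻¹' cB (α '' U) := by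
      rw [← hα _ (cB.idempotent _)]
      exact cA.monotone (Set.image_subset_iff.mp (cB.le_closure _))
    rw [Set.mem_preimage, himage, hopen, Set.mem_preimage, hea]
    exact hclosure ha
end

section
/- Let X, Y, Z be closure spaces, let h : Y → Z be a surjective morphism that is a regular epimorphism (for every Z' ⊆ Z, Z' is closed in Z if and only if h⁻¹(Z') is closed in Y), and let f, g : X → Y be morphisms such that h⁻¹(h(Y')) = f(g⁻¹(Y')) for every Y' ⊆ Y (as holds when X is the set-theoretic kernel pair of h with its two projections). If f is an open map, then h is an open map. -/
/-- Proposition 6.4 (open case): if `h : Y → Z` is a surjective regular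
epimorphism of closure spaces and `f, g : X → Y` are morphisms with
`h⁻¹(h(Y')) = f(g⁻¹(Y'))` for every `Y' ⊆ Y` (as for the kernel pair of `h`),
then `h` is an open map whenever `f` is. -/
theorem open_descends_along_regular_epi {X Y Z : Type*}
    (cX : ClosureOperator (Set X)) (cY : ClosureOperator (Set Y))
    (cZ : ClosureOperator (Set Z)) (h : Y → Z) (f g : X → Y)
    (hsurj : Function.Surjective h)
    (hcont : ∀ Z' : Set Z, cZ Z' = Z' → cY (h ⁻¹' Z') = h ⁻¹' Z')
    (hreg : ∀ Z' : Set Z, cZ Z' = Z' ↔ cY (h ⁻¹' Z') = h ⁻¹' Z')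
    (hf : ∀ Y' : Set Y, cY Y' = Y' → cX (f ⁻¹' Y') = f ⁻¹' Y')
    (hg : ∀ Y' : Set Y, cY Y' = Y' → cX (g ⁻¹' Y') = g ⁻¹' Y')
    (hfg : ∀ Y' : Set Y, h ⁻¹' (h '' Y') = f '' (g ⁻¹' Y'))
    (hfopen : ∀ W : Set X, cX Wᶜ = Wᶜ → cY (f '' W)ᶜ = (f '' W)ᶜ) :
    ∀ Y' : Set Y, cY Y'ᶜ = Y'ᶜ → cZ (h '' Y')ᶜ = (h '' Y')ᶜ := by
  intro Y' hY'
  rw [hreg, Set.preimage_compl, hfg]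
  exact hfopen (g ⁻¹' Y') (hg Y'ᶜ hY')
end

section
/- Every surjective closed morphism of closure spaces is a descent morphism: if p : E → B is a surjective morphism of closure spaces such that p(Y) is closed in B for every closed Y ⊆ E, then cl_B(X) = p(cl_E(p⁻¹(X))) for every X ⊆ B. -/
/-- Every surjective closed morphism of closure spaces is a descent morphism:
`cl_B(X) = p(cl_E(p⁻¹(X)))` for every `X ⊆ B`. -/
theorem surjective_closed_is_descent {E B : Type*}
    (cE : ClosureOperator (Set E)) (cB : ClosureOperator (Set B)) (p : E → B)
    (hsurj : Function.Surjective p)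
    (hcont : ∀ B' : Set B, cB B' = B' → cE (p ⁻¹' B') = p ⁻¹' B')
    (hclosed : ∀ Y : Set E, cE Y = Y → cB (p '' Y) = p '' Y) :
    ∀ X : Set B, cB X = p '' cE (p ⁻¹' X) := by
  intro X
  apply Set.Subset.antisymm
  · rw [← hclosed _ (cE.idempotent _)]
    apply cB.monotone
    calc X = p '' (p ⁻¹' X) := (Set.image_preimage_eq X hsurj).symm
      _ ⊆ p '' cE (p ⁻¹' X) := Set.image_mono (cE.le_closure _)
  · rw [Set.image_subset_iff, ← hcont _ (cB.idempotent X)]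
    exact cE.monotone (Set.preimage_mono (cB.le_closure X))
end
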